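/- arXiv:1409.4128 — 2 statements merged into one kernel-verified Lean document; each statement's English description precedes it below -/
import Mathlib

section
/- For every positive integer A there exists a constant C_A > 0 such that the following holds for every integer m ≥ A: if x_0, x_1, …, x_m is a sequence of real numbers satisfying Σ_{k=0}^{A} (−1)^k · binom(A, k) · x_{i−k} ≥ 1 for all integers i with A ≤ i ≤ m, then there exist indices 0 ≤ i, j ≤ m with |x_i − x_j| ≥ C_A · m^A. -/
open Finset

open scoped fwdDiff

/-- A difference with step `h` is the sum of the `h` consecutive unit differences it spans. -/
lemma fwdDiff_eq_sum_fwdDiff_one {G : Type*} [AddCommGroup G] (h : ℕ) (f : ℕ → G) :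
    Δ_[h] f = fun y ↦ ∑ j ∈ range h, Δ_[1] f (y + j) := by
  funext y
  simpa [fwdDiff, add_assoc] using (sum_range_sub (fun j ↦ f (y + j)) h).symm

/-- A lower bound on the `n`-th unit differences gives one on the `n`-th differences
with step `h`. -/
lemma pow_mul_le_fwdDiff_iter {h : ℕ} (n : ℕ) {f : ℕ → ℝ} {c : ℝ} {y : ℕ}
    (hf : ∀ i, y ≤ i → i + n ≤ y + n * h → c ≤ Δ_[1] ^[n] f i) :
    (h : ℝ) ^ n * c ≤ Δ_[h] ^[n] f y := by
  induction n generalizing f c with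
  | zero => simpa using hf y le_rfl (by simp)
  | succ n ih =>
    rw [Function.iterate_succ_apply, pow_succ, mul_assoc]
    refine ih fun i hi hin ↦ ?_
    have key : Δ_[1] ^[n] (Δ_[h] f) i = ∑ j ∈ range h, Δ_[1] ^[n + 1] f (i + j) := by
      have hsum : Δ_[h] f = ∑ j ∈ range h, fun y ↦ Δ_[1] f (y + j) := by
        rw [fwdDiff_eq_sum_fwdDiff_one]
        ext y
        simp
      rw [hsum, fwdDiff_iter_finsetSum, Finset.sum_apply]
      refine sum_congr rfl fun j _ ↦ ?_
      rw [fwdDiff_iter_comp_add, Function.iterate_succ_apply]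
    rw [key]
    calc (h : ℝ) * c = ∑ j ∈ range h, c := by simp
      _ ≤ _ := sum_le_sum fun j hj ↦ hf _ (by omega) (by
        rw [mem_range] at hj
        rw [add_one_mul]
        omega)

/-- If the values of `f` on `{0, …, m}` are within `D` of each other, then its iterated differences
taken inside `{0, …, m}` grow at most geometrically. -/
lemma abs_fwdDiff_iter_succ_le {f : ℕ → ℝ} {D : ℝ} {m h : ℕ}
    (hf : ∀ i ≤ m, ∀ j ≤ m, |f i - f j| ≤ D) (n : ℕ) {y : ℕ} (hy : y + (n + 1) * h ≤ m) :
    |Δ_[h] ^[n + 1] f y| ≤ 2 ^ n * D := by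
  induction n generalizing y with
  | zero => simpa [fwdDiff] using hf (y + h) (by omega) y (by omega)
  | succ n ih =>
    rw [add_one_mul] at hy
    rw [Function.iterate_succ_apply', fwdDiff]
    have h₁ := ih (y := y + h) (by omega)
    have h₂ := ih (y := y) (by omega)
    calc _ ≤ _ := abs_sub _ _
      _ ≤ 2 ^ n * D + 2 ^ n * D := add_le_add h₁ h₂
      _ = 2 ^ (n + 1) * D := by ring

/-- The iterated unit forward difference, written as a backward difference at its right end. -/
lemma fwdDiff_one_iter_eq_sum_backward (n i : ℕ) (f : ℕ → ℝ) :
    Δ_[1] ^[n] f i = ∑ k ∈ range (n + 1), (-1 : ℝ) ^ k * (n.choose k) * f (i + n - k) := by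
  rw [fwdDiff_iter_eq_sum_shift, ← sum_range_reflect]
  refine sum_congr rfl fun k hk ↦ ?_
  have hkn : k ≤ n := Nat.lt_succ_iff.mp (mem_range.mp hk)
  have h₁ : n + 1 - 1 - k = n - k := by omega
  rw [h₁, Nat.sub_sub_self hkn, Nat.choose_symm hkn, smul_eq_mul, mul_one, ← Nat.add_sub_assoc hkn]
  simp

/-- If the `A`-th backward finite difference of a real sequence is at least `1` at every
admissible index up to `m`, then the sequence has two terms at distance at least
`C_A · m^A` from each other. -/
theorem finite_difference_spread (A : ℕ) (hA : 0 < A) :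
    ∃ C_A : ℝ, 0 < C_A ∧ ∀ m : ℕ, A ≤ m → ∀ x : ℕ → ℝ,
      (∀ i : ℕ, A ≤ i → i ≤ m →
        1 ≤ ∑ k ∈ Finset.range (A + 1), (-1 : ℝ) ^ k * (A.choose k) * x (i - k)) →
      ∃ i ≤ m, ∃ j ≤ m, C_A * (m : ℝ) ^ A ≤ |x i - x j| := by
  have hA' : (0 : ℝ) < A := by exact_mod_cast hA
  refine ⟨((4 * A : ℝ) ^ A)⁻¹, by positivity, fun m hm x hx ↦ ?_⟩
  by_contra! hlt
  set h := m / A with hh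
  have hh₁ : 1 ≤ h := (Nat.one_le_div_iff hA).mpr hm
  have hhm : A * h ≤ m := Nat.mul_div_le m A
  have hm2 : m ≤ 2 * A * h := by
    have := Nat.lt_mul_div_succ m hA
    rw [← hh] at this
    nlinarith
  have lower : (h : ℝ) ^ A * 1 ≤ Δ_[h] ^[A] x 0 := by
    refine pow_mul_le_fwdDiff_iter A fun i _ hi ↦ ?_
    rw [fwdDiff_one_iter_eq_sum_backward]
    exact hx (i + A) (by omega) (by omega)
  obtain ⟨n, rfl⟩ := Nat.exists_eq_add_one_of_ne_zero hA.ne'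
  have upper := abs_fwdDiff_iter_succ_le (h := h) (fun i hi j hj ↦ (hlt i hi j hj).le) n
    (y := 0) (by omega)
  have hpow : (m : ℝ) ^ (n + 1) ≤ (2 * (n + 1 : ℕ) * h) ^ (n + 1) := by
    gcongr
    exact_mod_cast hm2
  have hpos : (0 : ℝ) < (h : ℝ) ^ (n + 1) := by positivity
  have : (h : ℝ) ^ (n + 1) ≤ (h : ℝ) ^ (n + 1) / 2 := calc
    (h : ℝ) ^ (n + 1) ≤ 2 ^ n * (((4 * (n + 1 : ℕ) : ℝ) ^ (n + 1))⁻¹ * (m : ℝ) ^ (n + 1)) := by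
      linarith [le_abs_self (Δ_[h] ^[n + 1] x 0)]
    _ ≤ 2 ^ n * (((4 * (n + 1 : ℕ) : ℝ) ^ (n + 1))⁻¹ * (2 * (n + 1 : ℕ) * h) ^ (n + 1)) := by
      gcongr
    _ = (h : ℝ) ^ (n + 1) / 2 := by
      rw [show (4 : ℝ) * (n + 1 : ℕ) = 2 * (2 * (n + 1 : ℕ)) by ring, mul_pow _ (h : ℝ),
        mul_pow 2 (2 * ((n + 1 : ℕ) : ℝ))]
      field_simp
      ring
  linarith
end

section
/- Let F : ℝ → ℝ be twice continuously differentiable and let G : ℝ → ℝ be continuous. Let x₀ ∈ ℝ, ε₁ > 0, M > 0, and set I := [x₀ − ε₁·M^{−1}, x₀ + ε₁·M^{−1}]. Assume: (a) F(x₀) = 0 and |F'(x₀)| ≥ ε₁; (b) |F''(x)| ≤ M for all x ∈ I; (c) sup_{x ∈ I} |F(x) − G(x)| ≤ (1/4)·ε₁²·M^{−1}. Then G has a root in I, i.e. there exists x ∈ I with G(x) = 0. -/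
open Set

/-- First-order Taylor estimate: a bound `M` on the second derivative between `a` and `x` bounds
the distance of `f x` from its linearization at `a` by `M * (x - a) ^ 2 / 2`. -/
theorem abs_sub_linearization_le {f : ℝ → ℝ} (hf : ContDiff ℝ 2 f) {a x M : ℝ}
    (hM : ∀ y ∈ Set.uIcc a x, |deriv (deriv f) y| ≤ M) :
    |f x - (f a + deriv f a * (x - a))| ≤ M * (x - a) ^ 2 / 2 := by
  rcases eq_or_ne a x with rfl | hne
  · simp
  obtain ⟨y, hy, h⟩ := taylor_mean_remainder_lagrange_iteratedDeriv (n := 1) hne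
    (hf.contDiffOn.of_le (by norm_num))
  have hderiv : derivWithin f (Set.uIcc a x) a = deriv f a :=
    (hf.differentiable (by norm_num) a).derivWithin
      (uniqueDiffOn_uIcc hne a Set.left_mem_uIcc)
  have hlin : taylorWithinEval f 1 (Set.uIcc a x) a x = f a + deriv f a * (x - a) := by
    rw [taylorWithinEval_succ, taylor_within_zero_eval, iteratedDerivWithin_one, hderiv]
    simp [mul_comm]
  have hiter : iteratedDeriv (1 + 1) f y = deriv (deriv f) y := by
    rw [iteratedDeriv_succ, iteratedDeriv_one]
  rw [hlin, hiter] at h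
  rw [h, abs_div, abs_mul, abs_of_nonneg (sq_nonneg (x - a))]
  norm_num
  gcongr
  exact hM y (Set.uIoo_subset_uIcc_self hy)

/-- Deterministic perturbation lemma: if `F` is `C²`, vanishes at `x₀` with
`|F'(x₀)| ≥ ε₁`, has second derivative bounded by `M` on
`I = [x₀ − ε₁/M, x₀ + ε₁/M]`, and `G` is continuous with
`|F − G| ≤ ε₁²/(4M)` on `I`, then `G` has a root in `I`. -/
theorem perturbation_root (F G : ℝ → ℝ) (hF : ContDiff ℝ 2 F) (hG : Continuous G)
    (x₀ ε₁ M : ℝ) (hε₁ : 0 < ε₁) (hM : 0 < M)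
    (hFx₀ : F x₀ = 0) (hF' : ε₁ ≤ |deriv F x₀|)
    (hF'' : ∀ x ∈ Set.Icc (x₀ - ε₁ * M⁻¹) (x₀ + ε₁ * M⁻¹), |deriv (deriv F) x| ≤ M)
    (hFG : ∀ x ∈ Set.Icc (x₀ - ε₁ * M⁻¹) (x₀ + ε₁ * M⁻¹),
      |F x - G x| ≤ (1 / 4) * ε₁ ^ 2 * M⁻¹) :
    ∃ x ∈ Set.Icc (x₀ - ε₁ * M⁻¹) (x₀ + ε₁ * M⁻¹), G x = 0 := by
  have hh : 0 < ε₁ * M⁻¹ := by positivity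
  have hI : x₀ - ε₁ * M⁻¹ ≤ x₀ + ε₁ * M⁻¹ := by linarith
  have hmem : x₀ ∈ Set.Icc (x₀ - ε₁ * M⁻¹) (x₀ + ε₁ * M⁻¹) := ⟨by linarith, by linarith⟩
  have hl := Set.left_mem_Icc.2 hI
  have hr := Set.right_mem_Icc.2 hI
  have hFl := abs_sub_linearization_le hF
    fun y hy => hF'' y (Set.uIcc_subset_Icc hmem hl hy)
  have hFr := abs_sub_linearization_le hF
    fun y hy => hF'' y (Set.uIcc_subset_Icc hmem hr hy)
  have hGl := hFG _ hl
  have hGr := hFG _ hr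
  have hsq : M * (ε₁ * M⁻¹) ^ 2 = ε₁ ^ 2 * M⁻¹ := by field_simp
  have hpos : 0 < ε₁ ^ 2 * M⁻¹ := by positivity
  have hslope : ε₁ ^ 2 * M⁻¹ ≤ |deriv F x₀| * (ε₁ * M⁻¹) := by
    calc ε₁ ^ 2 * M⁻¹ = ε₁ * (ε₁ * M⁻¹) := by ring
      _ ≤ _ := by gcongr
  simp only [hFx₀, zero_add, sub_sub_cancel_left, add_sub_cancel_left, neg_sq, mul_neg,
    hsq] at hFl hFr
  rw [abs_le] at hFl hFr hGl hGr
  have hzero : (0 : ℝ) ∈ Set.uIcc (G (x₀ - ε₁ * M⁻¹)) (G (x₀ + ε₁ * M⁻¹)) := by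
    rw [Set.mem_uIcc]
    rcases abs_cases (deriv F x₀) with ⟨habs, -⟩ | ⟨habs, -⟩ <;> rw [habs] at hslope
    · left
      constructor <;> linarith
    · right
      constructor <;> linarith
  obtain ⟨x, hx, hGx⟩ := intermediate_value_uIcc hG.continuousOn hzero
  exact ⟨x, Set.uIcc_subset_Icc hl hr hx, hGx⟩
end
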